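/- Let Φ be a finite reduced root system in a real vector space V, with dual root system in V* and canonical pairing ⟨·,·⟩ : V × V* → ℝ, and Weyl group W acting on V and contragrediently on V*. Fix a system of positive roots Φ⁺ with corresponding basis Π. Let Π_M ⊆ Π, let Φ_M be the set of roots lying in the integral span of Π_M, set Φ_M⁺ = Φ_M ∩ Φ⁺, let W_M ≤ W be the subgroup generated by the reflections s_α for α ∈ Π_M, and let W^M = { w ∈ W : w(Φ_M⁺) ⊆ Φ⁺ }. Suppose x ∈ V* is fixed by every element of W_M and satisfies ⟨α, x⟩ > 0 for all α ∈ Φ⁺ \ Φ_M⁺. Then for every v ∈ W^M with v ≠ 1 there exists α ∈ Φ⁺ \ Φ_M⁺ such that ⟨α, v⁻¹(x)⟩ < 0. -/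

import Mathlib

open Module
open scoped Pointwise

section BasedRootSystem

variable {V : Type*} [AddCommGroup V] [Module ℝ V]

/-- The reflections `z ↦ z - coroot α z • α` for `α` in a set `A`. -/
def reflectionSet (coroot : V → Dual ℝ V) (A : Set V) : Set (V ≃ₗ[ℝ] V) :=
  {w | ∃ α ∈ A, ∀ z : V, w z = z - coroot α z • α}

/-- A finite reduced root system `Φ` with positive roots `Φpos` and base `Pi`. -/
structure IsBasedRootSystem (Φ : Set V) (coroot : V → Dual ℝ V) (Φpos Pi : Set V) : Prop where
  finite : Φ.Finite
  span_eq_top : Submodule.span ℝ Φ = ⊤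
  coroot_self : ∀ α ∈ Φ, coroot α α = 2
  reflection_mem : ∀ α ∈ Φ, ∀ β ∈ Φ, β - coroot α β • α ∈ Φ
  reduced : ∀ α ∈ Φ, ∀ c : ℝ, c • α ∈ Φ → c = 1 ∨ c = -1
  pos_subset : Φpos ⊆ Φ
  pos_iff : ∀ α ∈ Φ, (α ∈ Φpos ↔ -α ∉ Φpos)
  base_subset : Pi ⊆ Φpos
  base_indep : LinearIndependent ℝ (fun α : Pi => (α : V))
  pos_mem_span : ∀ α ∈ Φpos, α ∈ Submodule.span ℕ Pi

namespace IsBasedRootSystem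

variable {Φ Φpos Pi : Set V} {coroot : V → Dual ℝ V}

lemma base_mem (h : IsBasedRootSystem Φ coroot Φpos Pi) {α : V} (hα : α ∈ Pi) : α ∈ Φ :=
  h.pos_subset (h.base_subset hα)

lemma exists_reflection (h : IsBasedRootSystem Φ coroot Φpos Pi) {α : V} (hα : α ∈ Φ) :
    ∃ w : V ≃ₗ[ℝ] V, ∀ z, w z = z - coroot α z • α :=
  ⟨Module.reflection (h.coroot_self α hα), fun _ => Module.reflection_apply _ _⟩

lemma reflection_mul_self (h : IsBasedRootSystem Φ coroot Φpos Pi) {α : V} (hα : α ∈ Φ)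
    {s : V ≃ₗ[ℝ] V} (hs : ∀ z, s z = z - coroot α z • α) : s * s = 1 := by
  ext z
  simp only [LinearEquiv.mul_apply, hs, map_sub, map_smul, h.coroot_self α hα,
    LinearEquiv.coe_one, id_eq, smul_eq_mul]
  module

lemma reflection_self (h : IsBasedRootSystem Φ coroot Φpos Pi) {α : V} (hα : α ∈ Φ)
    {s : V ≃ₗ[ℝ] V} (hs : ∀ z, s z = z - coroot α z • α) : s α = -α := by
  rw [hs, h.coroot_self α hα]
  module

lemma neg_pos_of_notMem (h : IsBasedRootSystem Φ coroot Φpos Pi) {α : V} (hα : α ∈ Φ)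
    (hn : α ∉ Φpos) : -α ∈ Φpos := by
  by_contra hc
  exact hn ((h.pos_iff α hα).2 hc)

lemma neg_notMem (h : IsBasedRootSystem Φ coroot Φpos Pi) {α : V} (hα : α ∈ Φpos) :
    -α ∉ Φpos :=
  (h.pos_iff α (h.pos_subset hα)).1 hα

lemma map_mem (h : IsBasedRootSystem Φ coroot Φpos Pi) {w : V ≃ₗ[ℝ] V}
    (hw : w ∈ Subgroup.closure (reflectionSet coroot Φ)) : ∀ β ∈ Φ, w β ∈ Φ := by
  induction hw using Subgroup.closure_induction'' with
  | one => exact fun β hβ => hβ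
  | mem w hw =>
    obtain ⟨α, hα, hw⟩ := hw
    intro β hβ
    rw [hw]
    exact h.reflection_mem α hα β hβ
  | inv_mem w hw =>
    obtain ⟨α, hα, hw⟩ := hw
    intro β hβ
    rw [inv_eq_of_mul_eq_one_left (h.reflection_mul_self hα hw), hw]
    exact h.reflection_mem α hα β hβ
  | mul u w _ _ hu hw => exact fun β hβ => hu _ (hw β hβ)

lemma coroot_map (h : IsBasedRootSystem Φ coroot Φpos Pi) {w : V ≃ₗ[ℝ] V}
    (hw : w ∈ Subgroup.closure (reflectionSet coroot Φ)) {α : V} (hα : α ∈ Φ) (z : V) :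
    coroot (w α) (w z) = coroot α z := by
  have hw' := h.map_mem (inv_mem hw)
  have hwα := h.map_mem hw α hα
  have key : coroot (w α) = (coroot α).comp (w⁻¹ : V ≃ₗ[ℝ] V).toLinearMap := by
    refine Dual.eq_of_preReflection_mapsTo h.finite h.span_eq_top (h.coroot_self _ hwα) ?_ ?_ ?_
    · intro β hβ
      simpa [preReflection_apply] using h.reflection_mem _ hwα β hβ
    · simp [h.coroot_self α hα]
    · intro β hβ
      have h1 := h.map_mem hw _ (h.reflection_mem α hα _ (hw' β hβ))
      have h2 : w ((w⁻¹ : V ≃ₗ[ℝ] V) β) = β := w.apply_symm_apply β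
      rw [map_sub, map_smul, h2] at h1
      simpa [preReflection_apply] using h1
  simp [key]

lemma nonneg_of_base (h : IsBasedRootSystem Φ coroot Φpos Pi) {f : Dual ℝ V}
    (hf : ∀ α ∈ Pi, 0 ≤ f α) {β : V} (hβ : β ∈ Φpos) : 0 ≤ f β := by
  have hspan := h.pos_mem_span β hβ
  clear hβ
  induction hspan using Submodule.span_induction with
  | mem x hx => exact hf x hx
  | zero => simp
  | add x y _ _ hx hy => rw [map_add]; exact add_nonneg hx hy
  | smul n x _ hx => rw [map_nsmul]; exact nsmul_nonneg hx n

lemma exists_basis (h : IsBasedRootSystem Φ coroot Φpos Pi) :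
    ∃ b : Basis Pi ℝ V, ∀ α (hα : α ∈ Pi), b ⟨α, hα⟩ = α := by
  refine ⟨Basis.mk h.base_indep ?_, fun _ _ => Basis.mk_apply _ _ _⟩
  rw [Subtype.range_coe, ← h.span_eq_top, Submodule.span_le]
  have hpos : ∀ β ∈ Φpos, β ∈ Submodule.span ℝ Pi := fun β hβ =>
    Submodule.span_le_restrictScalars ℕ ℝ Pi (h.pos_mem_span β hβ)
  intro β hβ
  by_cases hp : β ∈ Φpos
  · exact hpos β hp
  · simpa using Submodule.neg_mem _ (hpos _ (h.neg_pos_of_notMem hβ hp))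

lemma reflection_pos (h : IsBasedRootSystem Φ coroot Φpos Pi) {α β : V} (hα : α ∈ Pi)
    (hβ : β ∈ Φpos) (hne : β ≠ α) : β - coroot α β • α ∈ Φpos := by
  classical
  obtain ⟨b, hb⟩ := h.exists_basis
  have hcoord : ∀ i : Pi, ∀ γ ∈ Φpos, 0 ≤ b.coord i γ := fun i γ hγ => by
    refine h.nonneg_of_base (fun δ hδ => ?_) hγ
    rw [← hb δ hδ, Basis.coord_apply, Basis.repr_self, Finsupp.single_apply]
    split_ifs <;> norm_num
  by_contra hn
  have hneg := h.neg_pos_of_notMem (h.reflection_mem α (h.base_mem hα) β (h.pos_subset hβ)) hn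
  have hbα : b ⟨α, hα⟩ = α := hb α hα
  have hzero : ∀ i : Pi, i ≠ ⟨α, hα⟩ → b.repr β i = 0 := fun i hi => by
    have h1 := hcoord i _ hneg
    have h2 := hcoord i _ hβ
    have h3 : b.repr α i = 0 := by
      conv_lhs => rw [← hbα]
      rw [Basis.repr_self, Finsupp.single_apply, if_neg hi.symm]
    simp [h3] at h1 h2
    linarith
  have hrepr : b.repr β = Finsupp.single ⟨α, hα⟩ (b.repr β ⟨α, hα⟩) := by
    ext i
    by_cases hi : i = ⟨α, hα⟩
    · subst hi; simp
    · rw [hzero i hi, Finsupp.single_apply, if_neg (Ne.symm hi)]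
  have hβα : β = b.repr β ⟨α, hα⟩ • α := by
    apply b.repr.injective
    have h1 : b.repr α = Finsupp.single ⟨α, hα⟩ 1 := by
      conv_lhs => rw [← hbα]
      exact b.repr_self _
    rw [map_smul, h1, Finsupp.smul_single, smul_eq_mul, mul_one]
    exact hrepr
  have hmem := h.pos_subset hβ
  rw [hβα] at hmem
  rcases h.reduced α (h.base_mem hα) _ hmem with hc | hc <;> rw [hc] at hβα
  · exact hne (by simpa using hβα)
  · refine h.neg_notMem (h.base_subset hα) ?_
    rw [neg_one_smul] at hβα
    rwa [← hβα]

lemma mem_closure_of_mem_pow (h : IsBasedRootSystem Φ coroot Φpos Pi) {k : ℕ}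
    {w : V ≃ₗ[ℝ] V} (hw : w ∈ reflectionSet coroot Pi ^ k) :
    w ∈ Subgroup.closure (reflectionSet coroot Φ) := by
  have hsub : reflectionSet coroot Pi ⊆ Subgroup.closure (reflectionSet coroot Φ) :=
    fun s ⟨α, hα, hs⟩ => Subgroup.subset_closure ⟨α, h.base_mem hα, hs⟩
  induction k generalizing w with
  | zero => rw [pow_zero, Set.mem_one] at hw; rw [hw]; exact one_mem _
  | succ k ih =>
    rw [pow_succ, Set.mem_mul] at hw
    obtain ⟨u, hu, s, hs, rfl⟩ := hw
    exact mul_mem (ih hu) (hsub hs)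

/-- The exchange property: a word in simple reflections sending a simple root `α` to a negative
root can be shortened after multiplication by the reflection in `α`. -/
lemma exists_mul_reflection_mem_pow (h : IsBasedRootSystem Φ coroot Φpos Pi) {k : ℕ}
    {w : V ≃ₗ[ℝ] V} (hw : w ∈ reflectionSet coroot Pi ^ k) {α : V} (hα : α ∈ Pi)
    {s : V ≃ₗ[ℝ] V} (hs : ∀ z, s z = z - coroot α z • α) (hneg : w α ∉ Φpos) :
    ∃ m, m + 1 = k ∧ w * s ∈ reflectionSet coroot Pi ^ m := by
  induction k generalizing w with
  | zero =>
    rw [pow_zero, Set.mem_one] at hw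
    subst hw
    exact absurd (h.base_subset hα) hneg
  | succ k ih =>
    refine ⟨k, rfl, ?_⟩
    rw [pow_succ', Set.mem_mul] at hw
    obtain ⟨t, ⟨β, hβ, ht⟩, u, hu, rfl⟩ := hw
    by_cases hc : u α ∈ Φpos
    · have huα : u α = β := by
        by_contra hne
        refine hneg ?_
        rw [LinearEquiv.mul_apply, ht]
        exact h.reflection_pos hβ hc hne
      have htu : t * u = u * s := by
        ext z
        rw [LinearEquiv.mul_apply, LinearEquiv.mul_apply, ht, hs, map_sub, map_smul, ← huα,
          h.coroot_map (h.mem_closure_of_mem_pow hu) (h.base_mem hα)]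
      rwa [htu, mul_assoc, h.reflection_mul_self (h.base_mem hα) hs, mul_one]
    · obtain ⟨m, rfl, hm⟩ := ih hu hc
      rw [mul_assoc, pow_succ']
      exact Set.mul_mem_mul ⟨β, hβ, ht⟩ hm

lemma eq_one_of_map_base_pos (h : IsBasedRootSystem Φ coroot Φpos Pi) {k : ℕ}
    {w : V ≃ₗ[ℝ] V} (hw : w ∈ reflectionSet coroot Pi ^ k) (hpos : ∀ α ∈ Pi, w α ∈ Φpos) :
    w = 1 := by
  induction k using Nat.strong_induction_on with
  | _ k ih =>
    cases k with
    | zero => rwa [pow_zero, Set.mem_one] at hw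
    | succ k =>
      rw [pow_succ, Set.mem_mul] at hw
      obtain ⟨u, hu, s, ⟨α, hα, hs⟩, rfl⟩ := hw
      have hneg : u α ∉ Φpos := by
        have := h.neg_notMem (hpos α hα)
        rwa [LinearEquiv.mul_apply, h.reflection_self (h.base_mem hα) hs, map_neg, neg_neg]
          at this
      obtain ⟨m, rfl, hm⟩ := h.exists_mul_reflection_mem_pow hu hα hs hneg
      exact ih m (by lia) hm

lemma exists_base_coroot_pos (h : IsBasedRootSystem Φ coroot Φpos Pi) {β : V}
    (hβ : β ∈ Φpos) : ∃ α ∈ Pi, 0 < coroot α β := by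
  classical
  let B : V → V → ℝ := fun y z => ∑ γ ∈ h.finite.toFinset, coroot γ y * coroot γ z
  have hself : ∀ α ∈ Φ, 0 < B α α := fun α hα =>
    Finset.sum_pos' (fun γ _ => mul_self_nonneg _)
      ⟨α, h.finite.mem_toFinset.2 hα, by rw [h.coroot_self α hα]; norm_num⟩
  have hadj : ∀ α ∈ Φ, ∀ z, coroot α z * B α α = 2 * B α z := fun α hα z => by
    obtain ⟨s, hs⟩ := h.exists_reflection hα
    have hsW : s ∈ Subgroup.closure (reflectionSet coroot Φ) :=
      Subgroup.subset_closure ⟨α, hα, hs⟩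
    have hss : ∀ y, s (s y) = y := fun y => by
      rw [← LinearEquiv.mul_apply, h.reflection_mul_self hα hs]; rfl
    have hinv : B (s α) (s z) = B α z := by
      refine Finset.sum_nbij' s s ?_ ?_ ?_ ?_ ?_
      · intro γ hγ
        exact h.finite.mem_toFinset.2 (h.map_mem hsW γ (h.finite.mem_toFinset.1 hγ))
      · intro γ hγ
        exact h.finite.mem_toFinset.2 (h.map_mem hsW γ (h.finite.mem_toFinset.1 hγ))
      · exact fun γ _ => hss γ
      · exact fun γ _ => hss γ
      · intro γ hγ
        have hγ' := h.finite.mem_toFinset.1 hγ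
        rw [← h.coroot_map hsW hγ' (s α), ← h.coroot_map hsW hγ' (s z), hss, hss]
    have hexp : B (s α) (s z) = coroot α z * B α α - B α z := by
      rw [h.reflection_self hα hs, hs]
      simp only [B, Finset.mul_sum, ← Finset.sum_sub_distrib]
      refine Finset.sum_congr rfl fun γ _ => ?_
      simp only [map_neg, map_sub, map_smul, smul_eq_mul]
      ring
    linarith
  by_contra! hc
  let g : Dual ℝ V := -∑ γ ∈ h.finite.toFinset, coroot γ β • coroot γ
  have hg : ∀ z, g z = -B z β := fun z => by
    simp [g, B, mul_comm]
  have hnn : 0 ≤ g β := by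
    refine h.nonneg_of_base (fun α hα => ?_) hβ
    have h1 := hself α (h.base_mem hα)
    have h2 := hadj α (h.base_mem hα) β
    have h3 := mul_nonpos_of_nonpos_of_nonneg (hc α hα) h1.le
    rw [hg]
    linarith
  rw [hg] at hnn
  linarith [hself β (h.pos_subset hβ)]

lemma reflection_mem_closure (h : IsBasedRootSystem Φ coroot Φpos Pi) {β : V} (hβ : β ∈ Φpos)
    {t : V ≃ₗ[ℝ] V} (ht : ∀ z, t z = z - coroot β z • β) :
    t ∈ Subgroup.closure (reflectionSet coroot Pi) := by
  obtain ⟨b, hb⟩ := h.exists_basis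
  let height : Dual ℝ V := b.constr ℝ fun _ => (1 : ℝ)
  have hheight : ∀ α ∈ Pi, height α = 1 := fun α hα => by
    rw [← hb α hα, Basis.constr_basis]
  have hwf : Φpos.WellFoundedOn (Function.onFun (· < ·) height) := by
    have : IsStrictOrder V (Function.onFun (· < ·) height) :=
      { irrefl := fun _ => lt_irrefl _, trans := fun _ _ _ => lt_trans }
    exact (h.finite.subset h.pos_subset).wellFoundedOn
  refine hwf.induction (P := fun β => ∀ t : V ≃ₗ[ℝ] V, (∀ z, t z = z - coroot β z • β) →
    t ∈ Subgroup.closure (reflectionSet coroot Pi)) hβ ?_ t ht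
  clear! β t
  intro β hβ ih t ht
  obtain ⟨α, hα, hlt⟩ := h.exists_base_coroot_pos hβ
  by_cases hne : β = α
  · exact Subgroup.subset_closure ⟨α, hα, by rwa [← hne]⟩
  obtain ⟨s, hs⟩ := h.exists_reflection (h.base_mem hα)
  have hsβ : s β ∈ Φpos := by rw [hs]; exact h.reflection_pos hα hβ hne
  obtain ⟨u, hu⟩ := h.exists_reflection (h.pos_subset hsβ)
  have hsPi : s ∈ Subgroup.closure (reflectionSet coroot Pi) :=
    Subgroup.subset_closure ⟨α, hα, hs⟩
  have hsΦ : s ∈ Subgroup.closure (reflectionSet coroot Φ) :=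
    Subgroup.subset_closure ⟨α, h.base_mem hα, hs⟩
  have hlow : height (s β) < height β := by
    rw [hs, map_sub, map_smul, hheight α hα, smul_eq_mul, mul_one]
    linarith
  have hss : ∀ y, s (s y) = y := fun y => by
    rw [← LinearEquiv.mul_apply, h.reflection_mul_self (h.base_mem hα) hs]; rfl
  have hconj : t = s * u * s := by
    ext z
    rw [LinearEquiv.mul_apply, LinearEquiv.mul_apply, ht, hu, map_sub, map_smul, hss, hss,
      h.coroot_map hsΦ (h.pos_subset hβ)]
  rw [hconj]
  exact mul_mem (mul_mem hsPi (ih _ hsβ hlow u hu)) hsPi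

lemma exists_mem_pow (h : IsBasedRootSystem Φ coroot Φpos Pi) {w : V ≃ₗ[ℝ] V}
    (hw : w ∈ Subgroup.closure (reflectionSet coroot Φ)) :
    ∃ k : ℕ, w ∈ reflectionSet coroot Pi ^ k := by
  have hle : Subgroup.closure (reflectionSet coroot Φ) ≤
      Subgroup.closure (reflectionSet coroot Pi) := by
    rw [Subgroup.closure_le]
    rintro t ⟨β, hβ, ht⟩
    by_cases hp : β ∈ Φpos
    · exact h.reflection_mem_closure hp ht
    · have hcor : ∀ z, coroot (-β) z = -coroot β z := fun z => by
        obtain ⟨s, hs⟩ := h.exists_reflection hβ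
        have hsW : s ∈ Subgroup.closure (reflectionSet coroot Φ) :=
          Subgroup.subset_closure ⟨β, hβ, hs⟩
        have h1 := h.coroot_map hsW hβ (s z)
        rw [← LinearEquiv.mul_apply, h.reflection_mul_self hβ hs, h.reflection_self hβ hs,
          LinearEquiv.coe_one, id_eq, hs, map_sub, map_smul, h.coroot_self β hβ] at h1
        rw [h1, smul_eq_mul]
        ring
      exact h.reflection_mem_closure (h.neg_pos_of_notMem hβ hp) fun z => by
        rw [ht, hcor, neg_smul_neg]
  replace hw := hle hw
  induction hw using Subgroup.closure_induction'' with
  | one => exact ⟨0, by simp⟩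
  | mem s hs => exact ⟨1, by simpa using hs⟩
  | inv_mem s hs =>
    obtain ⟨α, hα, hs'⟩ := hs
    refine ⟨1, ?_⟩
    rw [inv_eq_of_mul_eq_one_left (h.reflection_mul_self (h.base_mem hα) hs'), pow_one]
    exact ⟨α, hα, hs'⟩
  | mul u w _ _ hu hw =>
    obtain ⟨m, hm⟩ := hu
    obtain ⟨n, hn⟩ := hw
    exact ⟨m + n, by rw [pow_add]; exact Set.mul_mem_mul hm hn⟩

/-- A dominant functional is the only dominant one in its Weyl group orbit. -/
lemma apply_eq_of_nonneg (h : IsBasedRootSystem Φ coroot Φpos Pi) {k : ℕ}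
    {w : V ≃ₗ[ℝ] V} (hw : w ∈ reflectionSet coroot Pi ^ k) {x : Dual ℝ V}
    (hx : ∀ β ∈ Φpos, 0 ≤ x β) (hxw : ∀ β ∈ Φpos, 0 ≤ x (w β)) (z : V) : x (w z) = x z := by
  induction k generalizing w z with
  | zero => rw [pow_zero, Set.mem_one] at hw; rw [hw]; rfl
  | succ k ih =>
    by_cases hpos : ∀ α ∈ Pi, w α ∈ Φpos
    · rw [h.eq_one_of_map_base_pos hw hpos]; rfl
    · push Not at hpos
      obtain ⟨α, hα, hneg⟩ := hpos
      obtain ⟨s, hs⟩ := h.exists_reflection (h.base_mem hα)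
      obtain ⟨m, hmk, hm⟩ := h.exists_mul_reflection_mem_pow hw hα hs hneg
      obtain rfl : m = k := by lia
      have hle := hx _ (h.neg_pos_of_notMem
        (h.map_mem (h.mem_closure_of_mem_pow hw) α (h.base_mem hα)) hneg)
      rw [map_neg] at hle
      have hzero : x (w α) = 0 := le_antisymm (by linarith) (hxw α (h.base_subset hα))
      have heq : ∀ y, x ((w * s) y) = x (w y) := fun y => by
        rw [LinearEquiv.mul_apply, hs]
        simp [hzero]
      rw [← heq, ih hm fun β hβ => by rw [heq]; exact hxw β hβ]

end IsBasedRootSystem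

end BasedRootSystem

theorem exists_neg_pairing_of_ne_one
    {V : Type*} [AddCommGroup V] [Module ℝ V] [FiniteDimensional ℝ V]
    (Φ : Set V) (hfin : Φ.Finite) (hzero : (0 : V) ∉ Φ)
    (hspan : Submodule.span ℝ Φ = ⊤)
    (coroot : V → Module.Dual ℝ V)
    (hpair : ∀ α ∈ Φ, coroot α α = 2)
    (hrefl : ∀ α ∈ Φ, ∀ β ∈ Φ, β - coroot α β • α ∈ Φ)
    (hcryst : ∀ α ∈ Φ, ∀ β ∈ Φ, ∃ n : ℤ, coroot α β = (n : ℝ))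
    (hreduced : ∀ α ∈ Φ, ∀ c : ℝ, c • α ∈ Φ → c = 1 ∨ c = -1)
    (Φpos : Set V) (hpos_sub : Φpos ⊆ Φ)
    (hpos : ∀ α ∈ Φ, (α ∈ Φpos ↔ -α ∉ Φpos))
    (Pi : Set V) (hPi_pos : Pi ⊆ Φpos)
    (hPi_indep : LinearIndependent ℝ (fun α : Pi => (α : V)))
    (hPi_span : ∀ α ∈ Φpos, α ∈ Submodule.span ℕ Pi)
    (PiM : Set V) (hPiM : PiM ⊆ Pi)
    (x : Module.Dual ℝ V)
    (hx_fix : ∀ w : V ≃ₗ[ℝ] V,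
      w ∈ Subgroup.closure
        {w : V ≃ₗ[ℝ] V | ∃ α ∈ PiM, ∀ z : V, w z = z - coroot α z • α} →
      ∀ z : V, x (w z) = x z)
    (hx_pos : ∀ α ∈ Φpos, α ∉ Submodule.span ℤ PiM → 0 < x α)
    (v : V ≃ₗ[ℝ] V)
    (hvW : v ∈ Subgroup.closure
      {w : V ≃ₗ[ℝ] V | ∃ α ∈ Φ, ∀ z : V, w z = z - coroot α z • α})
    (hvWM : ∀ α ∈ Φpos, α ∈ Submodule.span ℤ PiM → v α ∈ Φpos)
    (hv_ne : v ≠ 1) :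
    ∃ α ∈ Φpos, α ∉ Submodule.span ℤ PiM ∧ x (v α) < 0 := by
  have h : IsBasedRootSystem Φ coroot Φpos Pi :=
    ⟨hfin, hspan, hpair, hrefl, hreduced, hpos_sub, hpos, hPi_pos, hPi_indep, hPi_span⟩
  have hxM : ∀ β ∈ Submodule.span ℤ PiM, x β = 0 := fun β hβ => by
    induction hβ using Submodule.span_induction with
    | mem α hα =>
      have hαΦ := h.base_mem (hPiM hα)
      obtain ⟨s, hs⟩ := h.exists_reflection hαΦ
      have := hx_fix s (Subgroup.subset_closure ⟨α, hα, hs⟩) α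
      rw [h.reflection_self hαΦ hs, map_neg] at this
      linarith
    | zero => exact map_zero x
    | add y z _ _ hy hz => rw [map_add, hy, hz, add_zero]
    | smul n y _ hy => rw [map_zsmul, hy, smul_zero]
  have hxnn : ∀ β ∈ Φpos, 0 ≤ x β := fun β hβ => by
    by_cases hM : β ∈ Submodule.span ℤ PiM
    · exact (hxM β hM).ge
    · exact (hx_pos β hβ hM).le
  by_contra! hc
  obtain ⟨k, hk⟩ := h.exists_mem_pow hvW
  have hxv : ∀ z, x (v z) = x z := h.apply_eq_of_nonneg hk hxnn fun β hβ => by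
    by_cases hM : β ∈ Submodule.span ℤ PiM
    · exact hxnn _ (hvWM β hβ hM)
    · exact hc β hβ hM
  refine hv_ne (h.eq_one_of_map_base_pos hk fun α hα => ?_)
  have hαpos := hPi_pos hα
  by_cases hM : α ∈ Submodule.span ℤ PiM
  · exact hvWM α hαpos hM
  · by_contra hn
    have h1 := hxnn _ (h.neg_pos_of_notMem (h.map_mem hvW α (hpos_sub hαpos)) hn)
    rw [map_neg, hxv] at h1
    linarith [hx_pos α hαpos hM]
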